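/- Let H = {0, 89, 178, 267, 356, 445, 534} ⊆ ℤ/623ℤ and let B = {0, 1, 7, 22, 62, 241, 276, 307} ⊆ ℤ/623ℤ. Then H is a subgroup of ℤ/623ℤ of order 7, and the eleven difference sets Δ(8ⁱ·B) for i = 0, 1, …, 10 are pairwise disjoint, each has cardinality 56, each is disjoint from H, and their union together with H \ {0} is (ℤ/623ℤ) \ {0}. -/

import Mathlib

/-- The set of differences `ΔB = {a - c : a, c ∈ B, a ≠ c}`. -/
def diffSet (B : Finset (ZMod 623)) : Finset (ZMod 623) :=
  ((B ×ˢ B).filter fun p => p.1 ≠ p.2).image fun p => p.1 - p.2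

/-- The subgroup block `H = {0, 89, 178, 267, 356, 445, 534}` of `ℤ/623ℤ`. -/
def Hblock : Finset (ZMod 623) := {0, 89, 178, 267, 356, 445, 534}

/-- The base block `B`. -/
def baseBlock : Finset (ZMod 623) := {0, 1, 7, 22, 62, 241, 276, 307}

/-- The dilates `8ⁱ · B` of the base block, for `i = 0, 1, …, 10`. -/
def dilate (i : Fin 11) : Finset (ZMod 623) :=
  baseBlock.image fun x => (8 : ZMod 623) ^ (i : ℕ) * x

theorem eight_pow_eleven : (8 : ZMod 623) ^ 11 = 1 := by
  decide +kernel

theorem isUnit_eight_pow (i : ℕ) : IsUnit ((8 : ZMod 623) ^ i) :=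
  (IsUnit.of_pow_eq_one eight_pow_eleven (by decide)).pow i

theorem diffSet_dilate (i : Fin 11) : diffSet (dilate i) =
    baseBlock.offDiag.image fun p => (8 : ZMod 623) ^ (i : ℕ) * (p.1 - p.2) := by
  ext x
  simp only [diffSet, dilate, Finset.mem_image, Finset.mem_filter, Finset.mem_product,
    Finset.mem_offDiag, Prod.exists]
  constructor
  · rintro ⟨_, _, ⟨⟨⟨a, ha, rfl⟩, b, hb, rfl⟩, hab⟩, rfl⟩
    exact ⟨a, b, ⟨ha, hb, fun h => hab (congrArg _ h)⟩, mul_sub _ _ _⟩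
  · rintro ⟨a, b, ⟨ha, hb, hab⟩, rfl⟩
    exact ⟨_, _, ⟨⟨⟨a, ha, rfl⟩, b, hb, rfl⟩, fun h => hab ((isUnit_eight_pow i).mul_left_cancel h)⟩,
      (mul_sub _ _ _).symm⟩

/-- Reduction modulo `89`, whose kernel is `Hblock`. -/
def reduceMod89 : ZMod 623 →+* ZMod 89 :=
  ZMod.castHom (by decide : 89 ∣ 623) (ZMod 89)

theorem reduceMod89_of_mem_Hblock : ∀ x ∈ Hblock, reduceMod89 x = 0 := by
  decide +kernel

theorem reduceMod89_injOn_baseBlock :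
    ∀ a ∈ baseBlock, ∀ b ∈ baseBlock, reduceMod89 a = reduceMod89 b → a = b := by
  decide +kernel

theorem eight_pow_mod_89_injective : ∀ i j : Fin 11,
    (8 : ZMod 89) ^ (i : ℕ) = 8 ^ (j : ℕ) → i = j := by
  decide +kernel

theorem card_offDiag_baseBlock : baseBlock.offDiag.card = 56 := by
  decide +kernel

/-- The `11`-th power is invariant under multiplication by `8`, and separates the differences
of the base block. -/
theorem sub_pow_eleven_injOn :
    Set.InjOn (fun p : ZMod 623 × ZMod 623 => (p.1 - p.2) ^ 11) baseBlock.offDiag := by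
  rw [← Finset.card_image_iff]
  decide +kernel

theorem reduceMod89_sub_ne_zero {p : ZMod 623 × ZMod 623} (hp : p ∈ baseBlock.offDiag) :
    reduceMod89 (p.1 - p.2) ≠ 0 := by
  obtain ⟨h₁, h₂, hne⟩ := Finset.mem_offDiag.1 hp
  rw [map_sub, sub_ne_zero]
  exact fun h => hne (reduceMod89_injOn_baseBlock _ h₁ _ h₂ h)

theorem prime_89 : Nat.Prime 89 := by
  norm_num

theorem reduceMod89_eight_pow (i : ℕ) : reduceMod89 (8 ^ i) = 8 ^ i := by
  rw [map_pow, map_ofNat]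

theorem eq_of_eight_pow_mul_sub_eq {i j : Fin 11} {p q : ZMod 623 × ZMod 623}
    (hp : p ∈ baseBlock.offDiag) (hq : q ∈ baseBlock.offDiag)
    (h : (8 : ZMod 623) ^ (i : ℕ) * (p.1 - p.2) = 8 ^ (j : ℕ) * (q.1 - q.2)) :
    i = j ∧ p = q := by
  have hpq : p = q := by
    refine sub_pow_eleven_injOn hp hq ?_
    have h11 := congrArg (· ^ 11) h
    simpa only [mul_pow, ← pow_mul, mul_comm _ 11, pow_mul _ 11, eight_pow_eleven, one_pow,
      one_mul] using h11
  subst hpq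
  have : Fact (Nat.Prime 89) := ⟨prime_89⟩
  have h89 := congrArg reduceMod89 h
  rw [map_mul, map_mul, reduceMod89_eight_pow, reduceMod89_eight_pow] at h89
  exact ⟨eight_pow_mod_89_injective _ _ (mul_right_cancel₀ (reduceMod89_sub_ne_zero hp) h89), rfl⟩

theorem card_diffSet_dilate (i : Fin 11) : (diffSet (dilate i)).card = 56 := by
  rw [diffSet_dilate, Finset.card_image_of_injOn, card_offDiag_baseBlock]
  exact fun p hp q hq h => (eq_of_eight_pow_mul_sub_eq hp hq h).2

theorem disjoint_diffSet_dilate (i j : Fin 11) (hij : i ≠ j) :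
    Disjoint (diffSet (dilate i)) (diffSet (dilate j)) := by
  rw [diffSet_dilate, diffSet_dilate, Finset.disjoint_left]
  intro x hi hj
  obtain ⟨p, hp, rfl⟩ := Finset.mem_image.1 hi
  obtain ⟨q, hq, h⟩ := Finset.mem_image.1 hj
  exact hij (eq_of_eight_pow_mul_sub_eq hq hp h).1.symm

theorem disjoint_diffSet_dilate_Hblock (i : Fin 11) :
    Disjoint (diffSet (dilate i)) Hblock := by
  rw [diffSet_dilate, Finset.disjoint_left]
  intro x hi hx
  obtain ⟨p, hp, rfl⟩ := Finset.mem_image.1 hi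
  have h := reduceMod89_of_mem_Hblock _ hx
  rw [map_mul] at h
  exact reduceMod89_sub_ne_zero hp
    ((((isUnit_eight_pow i).map reduceMod89).mul_right_eq_zero).1 h)

theorem card_Hblock : Hblock.card = 7 := by
  decide +kernel

theorem zero_mem_Hblock : (0 : ZMod 623) ∈ Hblock :=
  Finset.mem_insert_self _ _

theorem exists_addSubgroup_coe_eq_Hblock :
    ∃ S : AddSubgroup (ZMod 623), (S : Set (ZMod 623)) = (Hblock : Set (ZMod 623)) := by
  have hadd : ∀ a ∈ Hblock, ∀ b ∈ Hblock, a + b ∈ Hblock := by decide +kernel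
  have hneg : ∀ a ∈ Hblock, -a ∈ Hblock := by decide +kernel
  exact ⟨{ carrier := Hblock
           add_mem' := fun {a b} ha hb => hadd a ha b hb
           zero_mem' := zero_mem_Hblock
           neg_mem' := fun {a} ha => hneg a ha }, rfl⟩

theorem Hblock_sdiff_union_biUnion_diffSet_dilate :
    (Hblock \ {0}) ∪ (Finset.univ.biUnion fun i => diffSet (dilate i)) = Finset.univ \ {0} := by
  have hdisj : Disjoint Hblock (Finset.univ.biUnion fun i => diffSet (dilate i)) :=
    (Finset.disjoint_biUnion_right _ _ _).2 fun i _ => (disjoint_diffSet_dilate_Hblock i).symm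
  have hcover : Hblock ∪ (Finset.univ.biUnion fun i => diffSet (dilate i)) = Finset.univ := by
    rw [← Finset.card_eq_iff_eq_univ, Finset.card_union_of_disjoint hdisj, card_Hblock,
      Finset.card_biUnion fun i _ j _ hij => disjoint_diffSet_dilate i j hij, ZMod.card]
    simp [card_diffSet_dilate]
  have h0 : (0 : ZMod 623) ∉ Finset.univ.biUnion fun i => diffSet (dilate i) :=
    Finset.disjoint_left.1 hdisj zero_mem_Hblock
  rw [← hcover, Finset.union_sdiff_distrib, Finset.sdiff_singleton_eq_erase 0 (Finset.biUnion _ _),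
    Finset.erase_eq_of_notMem h0]

/-- `H` is a subgroup of `ℤ/623ℤ` of order `7`, and the eleven difference sets
`Δ(8ⁱ · B)`, `i = 0, …, 10`, are pairwise disjoint, each has cardinality `56`,
each is disjoint from `H`, and their union together with `H \ {0}` is
`ℤ/623ℤ \ {0}`. -/
theorem one_rotational_difference_family_zmod_623_18 :
    (∃ S : AddSubgroup (ZMod 623), (S : Set (ZMod 623)) = (Hblock : Set (ZMod 623))) ∧
    Hblock.card = 7 ∧
    (∀ i j, i ≠ j → Disjoint (diffSet (dilate i)) (diffSet (dilate j))) ∧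
    (∀ i, (diffSet (dilate i)).card = 56) ∧
    (∀ i, Disjoint (diffSet (dilate i)) Hblock) ∧
    (Hblock \ {0}) ∪ (Finset.univ.biUnion fun i => diffSet (dilate i)) =
      Finset.univ \ {0} := by
  exact ⟨exists_addSubgroup_coe_eq_Hblock, card_Hblock, disjoint_diffSet_dilate,
    card_diffSet_dilate, disjoint_diffSet_dilate_Hblock,
    Hblock_sdiff_union_biUnion_diffSet_dilate⟩
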